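/- In the space ℂ^{ℕ₀} of all complex sequences with the product topology, there exist a set I with card(I) = 𝔠 and a linearly independent family (F^k)_{k∈I} of dense vector subspaces of ℂ^{ℕ₀} such that the vector subspace spanned by ⋃_{k∈I} F^k is contained in (ℂ^{ℕ₀} \ H(𝔻)) ∪ {0}, where H(𝔻) = {x : limsup_n |x(n)|^{1/n} ≤ 1}. -/

import Mathlib

open Filter Topology

/-- `H(𝔻)`, viewed as a sequence space via Taylor coefficients:
the set of `x : ℕ → ℂ` with `limsup |x n| ^ (1/n) ≤ 1`. -/
noncomputable def HdSet : Set (ℕ → ℂ) :=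
  {x | Filter.limsup (fun n => ‖x n‖ ^ (1 / (n : ℝ))) atTop ≤ 1}

/-- The geometric sequence `n ↦ t ^ n`, as a complex sequence. -/
noncomputable def geomSeq (t : ℝ) : ℕ → ℂ := fun n => (t : ℂ) ^ n

/-- If `x n / M ^ n` has a nonzero limit for some `M > 1`, then `x ∉ H(𝔻)`. -/
theorem notMem_HdSet_of_tendsto {x : ℕ → ℂ} {M : ℝ} {a : ℂ} (hM : 1 < M) (ha : a ≠ 0)
    (h : Tendsto (fun n => x n / (M : ℂ) ^ n) atTop (𝓝 a)) : x ∉ HdSet := by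
  intro hx
  have hM0 : 0 < M := by linarith
  have hn := h.norm
  have hbdd : IsBoundedUnder (· ≤ ·) atTop (fun n => ‖x n‖ ^ (1 / (n : ℝ))) := by
    refine isBoundedUnder_of_eventually_le (a := (‖a‖ + 1) * M) ?_
    filter_upwards [hn.eventually_lt_const (lt_add_one ‖a‖), eventually_ge_atTop 1] with n hlt hn1
    have hn0 : n ≠ 0 := by omega
    have hn1' : (1 : ℝ) ≤ n := by exact_mod_cast hn1
    rw [norm_div, norm_pow, Complex.norm_of_nonneg hM0.le, div_lt_iff₀ (by positivity)] at hlt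
    have hle : ‖x n‖ ≤ ((‖a‖ + 1) * M) ^ n := by
      rw [mul_pow]
      refine hlt.le.trans ?_
      gcongr
      exact le_self_pow₀ (by linarith [norm_nonneg a]) hn0
    calc ‖x n‖ ^ (1 / (n : ℝ)) ≤ (((‖a‖ + 1) * M) ^ n) ^ (1 / (n : ℝ)) := by gcongr
      _ = (‖a‖ + 1) * M := by
        rw [one_div, Real.pow_rpow_inv_natCast (by positivity) hn0]
  obtain ⟨r, hr1, hrM⟩ := exists_between hM
  have hr0 : 0 < r := by linarith
  have hev := eventually_lt_of_limsup_lt (lt_of_le_of_lt hx hr1) hbdd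
  have hzero : Tendsto (fun n => (r / M) ^ n) atTop (𝓝 0) :=
    tendsto_pow_atTop_nhds_zero_of_lt_one (by positivity) ((div_lt_one hM0).2 hrM)
  have hle : ‖a‖ ≤ 0 := by
    refine le_of_tendsto_of_tendsto hn hzero ?_
    filter_upwards [hev, eventually_ge_atTop 1] with n hlt hn1
    have hn0 : n ≠ 0 := by omega
    rw [norm_div, norm_pow, Complex.norm_of_nonneg hM0.le, div_pow]
    gcongr
    calc ‖x n‖ = (‖x n‖ ^ (1 / (n : ℝ))) ^ n := by
          rw [one_div, Real.rpow_inv_natCast_pow (norm_nonneg _) hn0]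
      _ ≤ r ^ n := by gcongr
  exact ha (norm_le_zero_iff.1 hle)

theorem linearCombination_geomSeq_notMem_HdSet {l : ℝ →₀ ℂ} (hl : ∀ t ∈ l.support, 1 < t)
    (h0 : l ≠ 0) : Finsupp.linearCombination ℂ geomSeq l ∉ HdSet := by
  have hne : l.support.Nonempty := Finsupp.support_nonempty_iff.2 h0
  set M := l.support.max' hne with hMdef
  have hMmem : M ∈ l.support := l.support.max'_mem hne
  have hM : 1 < M := hl M hMmem
  refine notMem_HdSet_of_tendsto hM (Finsupp.mem_support_iff.1 hMmem) ?_
  have hsum : (fun n => Finsupp.linearCombination ℂ geomSeq l n / (M : ℂ) ^ n) =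
      fun n => ∑ t ∈ l.support, l t * ((t : ℂ) / M) ^ n := by
    funext n
    simp [Finsupp.linearCombination_apply, Finsupp.sum, geomSeq, Finset.sum_div, div_pow,
      mul_div_assoc]
  rw [hsum]
  have hlim : l M = ∑ t ∈ l.support, if t = M then l t else 0 := by
    rw [Finset.sum_ite_eq' l.support M, if_pos hMmem]
  rw [hlim]
  refine tendsto_finsetSum _ fun t ht => ?_
  have ht1 : 1 < t := hl t ht
  have hM0 : (M : ℂ) ≠ 0 := by exact_mod_cast (by linarith : M ≠ 0)
  split_ifs with htM
  · simp [htM, div_self hM0]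
  · have hlt : t < M := lt_of_le_of_ne (l.support.le_max' t ht) htM
    rw [← mul_zero (l t)]
    refine (tendsto_pow_atTop_nhds_zero_of_norm_lt_one ?_).const_mul (l t)
    rw [norm_div, Complex.norm_of_nonneg (by linarith), Complex.norm_of_nonneg (by linarith)]
    exact (div_lt_one (by linarith)).2 hlt

theorem zero_mem_HdSet : (0 : ℕ → ℂ) ∈ HdSet := by
  have hev : (fun n : ℕ => ‖(0 : ℕ → ℂ) n‖ ^ (1 / (n : ℝ))) =ᶠ[atTop] fun _ => (0 : ℝ) := by
    filter_upwards [eventually_ge_atTop 1] with n hn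
    have : (n : ℝ)⁻¹ ≠ 0 := inv_ne_zero (by exact_mod_cast (by omega : n ≠ 0))
    simp [Real.zero_rpow this]
  rw [HdSet, Set.mem_ofPred_eq]
  rw [limsup_congr hev, limsup_const]
  exact zero_le_one

theorem linearIndepOn_geomSeq : LinearIndepOn ℂ geomSeq (Set.Ioi 1) := by
  rw [linearIndepOn_iff]
  intro l hl h
  by_contra h0
  exact linearCombination_geomSeq_notMem_HdSet (fun _ ht => hl ht) h0 (h ▸ zero_mem_HdSet)

/-- Geometric sequences with infinitely many ratios span a dense subspace: by the Vandermonde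
determinant, their span interpolates arbitrary values on any finite set of coordinates. -/
theorem dense_span_geomSeq {s : Set ℝ} (hs : s.Infinite) :
    Dense (Submodule.span ℂ (geomSeq '' s) : Set (ℕ → ℂ)) := by
  intro x
  have hinterp (N : ℕ) : ∃ y ∈ Submodule.span ℂ (geomSeq '' s), ∀ i < N, y i = x i := by
    set f := hs.natEmbedding
    let w : Fin N → ℂ := fun i => ((f i : ℝ) : ℂ)
    have hw : Function.Injective w := fun i j hij => by
      have h1 : f i = f j := Subtype.ext (Complex.ofReal_injective hij)
      exact Fin.ext (f.injective h1)
    have hdet : IsUnit (Matrix.vandermonde w).det :=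
      (Matrix.det_vandermonde_ne_zero_iff.2 hw).isUnit
    let c : Fin N → ℂ := Matrix.vecMul (fun i : Fin N => x i) (Matrix.vandermonde w)⁻¹
    have hc : Matrix.vecMul c (Matrix.vandermonde w) = fun i : Fin N => x i := by
      simp only [c]
      rw [Matrix.vecMul_vecMul, Matrix.nonsing_inv_mul _ hdet, Matrix.vecMul_one]
    refine ⟨∑ i, c i • geomSeq (f i), Submodule.sum_mem _ fun i _ => Submodule.smul_mem _ _
      (Submodule.subset_span ⟨_, (f i).2, rfl⟩), fun i hi => ?_⟩
    have := congrFun hc ⟨i, hi⟩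
    simpa [Matrix.vecMul, dotProduct, Matrix.vandermonde_apply, w, geomSeq] using this
  choose y hy hyx using hinterp
  refine mem_closure_of_tendsto (f := y) (b := atTop) ?_ (Eventually.of_forall hy)
  refine tendsto_pi_nhds.2 fun i => tendsto_const_nhds.congr' ?_
  filter_upwards [eventually_gt_atTop i] with N hN
  exact (hyx N i hN).symm

/-- The ratios `k + 1, k + 2, …`; for `k ∈ (0, 1)` these sets are pairwise disjoint. -/
def shiftedNats (k : ℝ) : Set ℝ := Set.range fun n : ℕ => k + (n + 1)

theorem infinite_shiftedNats (k : ℝ) : (shiftedNats k).Infinite :=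
  Set.infinite_range_of_injective fun m n h => by simpa using h

theorem shiftedNats_subset_Ioi {k : ℝ} (hk : 0 < k) : shiftedNats k ⊆ Set.Ioi 1 := by
  rintro _ ⟨n, rfl⟩
  have : (0 : ℝ) ≤ n := n.cast_nonneg
  simp only [Set.mem_Ioi]
  linarith

theorem fract_of_mem_shiftedNats {k t : ℝ} (hk : k ∈ Set.Ioo 0 1) (ht : t ∈ shiftedNats k) :
    Int.fract t = k := by
  obtain ⟨n, rfl⟩ := ht
  have h : k + ((n : ℝ) + 1) = k + ((n + 1 : ℕ) : ℝ) := by push_cast; rfl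
  simp only [h, Int.fract_add_natCast]
  exact Int.fract_eq_self.2 ⟨hk.1.le, hk.2⟩

theorem iSupIndep_span_geomSeq :
    iSupIndep fun k : Set.Ioo (0 : ℝ) 1 => Submodule.span ℂ (geomSeq '' shiftedNats k) := by
  intro k
  have hsub : ∀ j : Set.Ioo (0 : ℝ) 1, shiftedNats j ⊆ Set.Ioi 1 :=
    fun j => shiftedNats_subset_Ioi j.2.1
  have hdisj : Disjoint (shiftedNats k) (⋃ j : Set.Ioo (0 : ℝ) 1, ⋃ _ : j ≠ k, shiftedNats j) := by
    rw [Set.disjoint_left]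
    intro t htk ht
    obtain ⟨j, hjk, htj⟩ := Set.mem_iUnion₂.1 ht
    exact hjk (Subtype.ext ((fract_of_mem_shiftedNats j.2 htj).symm.trans
      (fract_of_mem_shiftedNats k.2 htk)))
  have hun := linearIndepOn_geomSeq.mono
    (Set.union_subset (hsub k) (Set.iUnion₂_subset fun j (_ : j ≠ k) => hsub j))
  refine ((linearIndepOn_union_iff hdisj).1 hun).2.2.mono_right ?_
  exact iSup₂_le fun j hj => Submodule.span_mono
    (Set.image_mono (Set.subset_iUnion₂_of_subset j hj subset_rfl))

/-- In the space `ℂ^ℕ` of all complex sequences with the product topology, there are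
continuum many linearly independent dense vector subspaces `F^k` such that the
vector subspace spanned by `⋃_k F^k` is contained in `(ℂ^ℕ \ H(𝔻)) ∪ {0}`. -/
theorem statement16 :
    ∃ (I : Type) (F : I → Submodule ℂ (ℕ → ℂ)),
      Cardinal.mk I = Cardinal.continuum ∧
      (∀ k, Dense (F k : Set (ℕ → ℂ))) ∧
      (∀ (J : Finset I) (v : I → (ℕ → ℂ)), (∀ k ∈ J, v k ∈ F k) →
        (∑ k ∈ J, v k) = 0 → ∀ k ∈ J, v k = 0) ∧
      (∀ v : ℕ → ℂ, v ∈ (⨆ k, F k : Submodule ℂ (ℕ → ℂ)) → v ≠ 0 → v ∉ HdSet) := by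
  refine ⟨Set.Ioo (0 : ℝ) 1, fun k => Submodule.span ℂ (geomSeq '' shiftedNats k),
    Cardinal.mk_Ioo_real zero_lt_one, fun k => dense_span_geomSeq (infinite_shiftedNats k), ?_, ?_⟩
  · intro J v hv hsum
    classical
    intro k hk
    refine Submodule.disjoint_def.1 (iSupIndep_span_geomSeq k) _ (hv k hk) ?_
    rw [← Finset.add_sum_erase J v hk] at hsum
    rw [eq_neg_of_add_eq_zero_left hsum]
    refine Submodule.neg_mem _ (Submodule.sum_mem _ fun j hj => ?_)
    obtain ⟨hjk, hjJ⟩ := Finset.mem_erase.1 hj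
    exact Submodule.mem_iSup_of_mem j (Submodule.mem_iSup_of_mem hjk (hv j hjJ))
  · intro v hv hv0
    have hle : (⨆ k : Set.Ioo (0 : ℝ) 1, Submodule.span ℂ (geomSeq '' shiftedNats k)) ≤
        Submodule.span ℂ (geomSeq '' Set.Ioi 1) :=
      iSup_le fun k => Submodule.span_mono (Set.image_mono (shiftedNats_subset_Ioi k.2.1))
    obtain ⟨l, hl, rfl⟩ := (Finsupp.mem_span_image_iff_linearCombination ℂ).1 (hle hv)
    refine linearCombination_geomSeq_notMem_HdSet (fun t ht => hl ht) ?_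
    rintro rfl
    exact hv0 (map_zero _)
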